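/- arXiv:2010.08594 — 3 statements merged into one kernel-verified Lean document; each statement's English description precedes it below -/
import Mathlib

section
/- The ring of integers of the number field L = ℚ(α), where α is the real fourth root of 2, equals ℤ[α]; that is, an element of L is an algebraic integer if and only if it is a ℤ-linear combination of 1, α, α², α³. -/
open IntermediateField Polynomial

noncomputable def alpha : ℝ := (2 : ℝ) ^ ((1 : ℝ) / 4)

noncomputable def L : IntermediateField ℚ ℝ := ℚ⟮alpha⟯

noncomputable def alphaL : L := ⟨alpha, IntermediateField.mem_adjoin_simple_self ℚ alpha⟩

noncomputable def u0 : L := (3 + 2 * alphaL ^ 2) + (2 + 2 * alphaL ^ 2) * alphaL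

theorem aux_alpha_pow : alpha ^ 4 = 2 := by
  unfold alpha
  rw [← Real.rpow_natCast, ← Real.rpow_mul (by norm_num)]
  norm_num

theorem aux_alphaL_pow : alphaL ^ 4 = 2 := by
  apply Subtype.ext
  have := aux_alpha_pow
  exact this

theorem aux_monic : (X ^ 4 - C 2 : ℤ[X]).Monic := monic_X_pow_sub_C _ (by norm_num)

theorem aux_eis : (X ^ 4 - C 2 : ℤ[X]).IsEisensteinAt (Submodule.span ℤ {(2 : ℤ)}) := by
  refine aux_monic.isEisensteinAt_of_mem_of_notMem ?_ ?_ ?_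
  · intro h
    have : (1 : ℤ) ∈ Ideal.span {(2 : ℤ)} := by
      rw [Ideal.eq_top_iff_one] at h
      exact h
    rw [Ideal.mem_span_singleton] at this
    omega
  · intro n hn
    rw [natDegree_X_pow_sub_C] at hn
    change _ ∈ Ideal.span {(2 : ℤ)}
    rw [Ideal.mem_span_singleton]
    interval_cases n <;> simp [coeff_X_pow, coeff_C]
  · change _ ∉ (Ideal.span {(2 : ℤ)}) ^ 2
    rw [Ideal.span_singleton_pow, Ideal.mem_span_singleton]
    simp [coeff_X_pow]

theorem aux_irr : Irreducible (X ^ 4 - C 2 : ℤ[X]) := by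
  refine aux_eis.irreducible ?_ aux_monic.isPrimitive ?_
  · exact (Ideal.span_singleton_prime (by norm_num)).2 Int.prime_two
  · rw [natDegree_X_pow_sub_C]; norm_num

theorem aux_minpoly_Q : minpoly ℚ alphaL = X ^ 4 - C 2 := by
  symm
  apply minpoly.eq_of_irreducible_of_monic
  · have := (aux_monic.irreducible_iff_irreducible_map_fraction_map (K := ℚ)).1 aux_irr
    have e : (X ^ 4 - C 2 : ℤ[X]).map (algebraMap ℤ ℚ) = X ^ 4 - C 2 := by
      rw [Polynomial.map_sub, Polynomial.map_pow, map_X, map_C]; rfl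
    rwa [e] at this
  · simp [aux_alphaL_pow]
  · exact monic_X_pow_sub_C _ (by norm_num)

theorem aux_int : IsIntegral ℤ alphaL :=
  ⟨X ^ 4 - C 2, aux_monic, by simp [aux_alphaL_pow]⟩

theorem aux_minpoly_Z : minpoly ℤ alphaL = X ^ 4 - C 2 := by
  have h := minpoly.isIntegrallyClosed_eq_field_fractions' ℚ aux_int
  rw [aux_minpoly_Q] at h
  apply map_injective (algebraMap ℤ ℚ) (algebraMap ℤ ℚ).injective_int
  rw [← h, Polynomial.map_sub, Polynomial.map_pow, map_X, map_C]
  rfl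

noncomputable def auxPB : PowerBasis ℚ L :=
  IntermediateField.adjoin.powerBasis (K := ℚ) (x := alpha)
    ((isIntegral_algebraMap_iff (algebraMap L ℝ).injective).2
      (aux_int.tower_top (A := ℚ)))

theorem auxPB_gen : auxPB.gen = alphaL := by
  apply Subtype.ext
  rfl

theorem aux_dim : auxPB.dim = 4 := by
  rw [← auxPB.natDegree_minpoly, auxPB_gen, aux_minpoly_Q, natDegree_X_pow_sub_C]

theorem aux_finrank : Module.finrank ℚ L = 4 := by
  rw [auxPB.finrank, aux_dim]

theorem aux_norm : Algebra.norm ℚ alphaL = -2 := by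
  rw [← auxPB_gen, Algebra.PowerBasis.norm_gen_eq_coeff_zero_minpoly, aux_dim, auxPB_gen,
    aux_minpoly_Q]
  simp
  norm_num

theorem aux_discr : Algebra.discr ℚ auxPB.basis = -2048 := by
  have := auxPB.finite
  rw [Algebra.discr_powerBasis_eq_norm, aux_finrank, auxPB_gen, aux_minpoly_Q]
  have : aeval alphaL (derivative (X ^ 4 - C 2 : ℚ[X])) = algebraMap ℚ L 4 * alphaL ^ 3 := by
    simp
    norm_num
  rw [this, map_mul, map_pow, aux_norm, Algebra.norm_algebraMap, aux_finrank]
  norm_num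

theorem aux_mem (z : L) (hz : IsIntegral ℤ z) : z ∈ Algebra.adjoin ℤ {alphaL} := by
  have := auxPB.finite
  have hint : IsIntegral ℤ auxPB.gen := by rw [auxPB_gen]; exact aux_int
  have H := Algebra.discr_mul_isIntegral_mem_adjoin ℚ hint hz
  rw [aux_discr] at H
  have H2 : (2 : ℤ) ^ 11 • z ∈ Algebra.adjoin ℤ {auxPB.gen} := by
    have := neg_mem H
    convert this using 1
    rw [Algebra.smul_def, Algebra.smul_def]
    simp
  have := mem_adjoin_of_smul_prime_pow_smul_of_minpoly_isEisensteinAt (n := 11)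
    Int.prime_two hint hz H2 (by rw [auxPB_gen, aux_minpoly_Z]; exact aux_eis)
  rwa [auxPB_gen] at this

theorem stmt0 (x : L) :
    IsIntegral ℤ x ↔ ∃ a b c d : ℤ,
      (x : ℝ) = a + b * alpha + c * alpha ^ 2 + d * alpha ^ 3 := by
  constructor
  · intro h
    have hx := aux_mem x h
    rw [Algebra.adjoin_singleton_eq_range_aeval] at hx
    obtain ⟨q, hq⟩ := hx
    have hr : aeval alphaL (q %ₘ (X ^ 4 - C 2)) = x := by
      rw [← hq]
      exact aeval_modByMonic_eq_self_of_root (by rw [map_sub, map_pow, aeval_X, aux_alphaL_pow, aeval_C]; simp)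
    have hdeg : (q %ₘ (X ^ 4 - C 2)).natDegree < 4 := by
      have := natDegree_modByMonic_lt q aux_monic (by
        intro h; have := congrArg natDegree h; rw [natDegree_X_pow_sub_C] at this; simp at this)
      rwa [natDegree_X_pow_sub_C] at this
    rw [aeval_eq_sum_range' hdeg] at hr
    generalize q %ₘ (X ^ 4 - C 2) = r at hr
    refine ⟨r.coeff 0, r.coeff 1, r.coeff 2, r.coeff 3, ?_⟩
    · rw [← hr]
      simp only [Finset.sum_range_succ, Finset.sum_range_zero, zsmul_eq_mul]
      push_cast
      simp only [alphaL, pow_zero, pow_one, mul_one, zero_add]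
  · rintro ⟨a, b, c, d, h⟩
    have : x = (a : L) + b * alphaL + c * alphaL ^ 2 + d * alphaL ^ 3 := by
      apply Subtype.ext
      rw [h]
      simp [alphaL]
    rw [this]
    have hi (n : ℤ) : IsIntegral ℤ (n : L) := isIntegral_algebraMap (R := ℤ) (A := L) (x := n)
    exact (((hi a).add ((hi b).mul aux_int)).add ((hi c).mul (aux_int.pow 2))).add
      ((hi d).mul (aux_int.pow 3))
end

section
/- The element u₀ = (3 + 2√2) + (2 + 2√2)·α is a unit of the ring of integers O_L, and it satisfies τ(u₀)·u₀ = 1. -/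
open IntermediateField Polynomial

/-- `u₀ = (3 + 2√2) + (2 + 2√2)·α` is a unit of the ring of integers `O_L`
(it is an algebraic integer with an algebraic-integer inverse), and `τ(u₀)·u₀ = 1`. -/
theorem stmt1 (τ : L ≃ₐ[ℚ] L) (hτ : τ alphaL = -alphaL) :
    IsIntegral ℤ u0 ∧ (∃ w : L, IsIntegral ℤ w ∧ u0 * w = 1) ∧ τ u0 * u0 = 1 := by
  have h4 : alphaL ^ 4 = 2 := by
    apply Subtype.ext
    change alpha ^ 4 = 2
    unfold alpha
    rw [← Real.rpow_natCast, ← Real.rpow_mul (by norm_num)]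
    norm_num
  have hi : IsIntegral ℤ alphaL := by
    apply IsIntegral.of_pow (n := 4) (by norm_num)
    rw [h4]
    exact_mod_cast isIntegral_algebraMap (R := ℤ) (A := L) (x := 2)
  have hn : ∀ n : ℤ, IsIntegral ℤ (n : L) := fun n => by
    simpa using isIntegral_algebraMap (R := ℤ) (A := L) (x := n)
  have h2 : IsIntegral ℤ (2 : L) := by exact_mod_cast hn 2
  have h3 : IsIntegral ℤ (3 : L) := by exact_mod_cast hn 3
  have ha := h3.add (h2.mul (hi.pow 2))
  have hb := (h2.add (h2.mul (hi.pow 2))).mul hi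
  refine ⟨ha.add hb, ⟨_, ha.sub hb, ?_⟩, ?_⟩
  · unfold u0
    linear_combination (-4 * alphaL ^ 2 - 4) * h4
  · have ht : τ u0 = (3 + 2 * alphaL ^ 2) - (2 + 2 * alphaL ^ 2) * alphaL := by
      unfold u0
      simp only [map_add, map_mul, map_pow, hτ, map_ofNat]
      ring
    rw [ht]
    unfold u0
    linear_combination (-4 * alphaL ^ 2 - 4) * h4
end

section
/- In the quotient ring (ℤ/4ℤ)[X]/(X⁴ - 2), none of the three elements -1, 2 + X², and -(2 + X²) is the square of an element of the ring. -/
open Polynomial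

/-- The ring `(ℤ/4ℤ)[X]/(X⁴ - 2)`. -/
abbrev R4 : Type := Polynomial (ZMod 4) ⧸ Ideal.span {(X : Polynomial (ZMod 4)) ^ 4 - C 2}

lemma sq_coeffs (t u : ZMod 4)
    (h : IsSquare (Ideal.Quotient.mk (Ideal.span {(X : Polynomial (ZMod 4)) ^ 4 - C 2})
        (C t + C u * X ^ 2))) :
    ∃ a b c d : ZMod 4, t = a * a + 2 * (2 * b * d + c * c) ∧ 0 = 2 * a * b + 2 * (2 * c * d) ∧
      u = 2 * a * c + b * b + 2 * (d * d) ∧ 0 = 2 * a * d + 2 * b * c := by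
  have : Nontrivial (ZMod 4) := ⟨0, 1, by decide⟩
  have hm : ((X : Polynomial (ZMod 4)) ^ 4 - C 2).Monic := monic_X_pow_sub_C 2 (by norm_num)
  have hdeg : ((X : Polynomial (ZMod 4)) ^ 4 - C 2).degree = 4 := degree_X_pow_sub_C (by norm_num) 2
  obtain ⟨x, hx⟩ := h
  obtain ⟨p, rfl⟩ := Ideal.Quotient.mk_surjective x
  have hr : (p %ₘ (X ^ 4 - C 2)).degree < (4 : ℕ) := by
    have := degree_modByMonic_lt p hm
    rw [hdeg] at this
    exact this
  have hp := modByMonic_add_div p (X ^ 4 - C 2)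
  generalize p %ₘ (X ^ 4 - C 2) = r at hr hp
  generalize p /ₘ (X ^ 4 - C 2) = q at hp
  have hr' := as_sum_range' r 4 (by
    by_cases h0 : r = 0
    · simp [h0]
    · exact (natDegree_lt_iff_degree_lt h0).2 hr)
  simp only [Finset.sum_range_succ, Finset.sum_range_zero, ← C_mul_X_pow_eq_monomial] at hr'
  generalize r.coeff 0 = a at hr'
  generalize r.coeff 1 = b at hr'
  generalize r.coeff 2 = c at hr'
  generalize r.coeff 3 = d at hr'
  refine ⟨a, b, c, d, ?_⟩
  rw [← map_mul, Ideal.Quotient.eq, Ideal.mem_span_singleton] at hx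
  have key : (X : Polynomial (ZMod 4)) ^ 4 - C 2 ∣
      C (t - (a * a + 2 * (2 * b * d + c * c))) + C (0 - (2 * a * b + 2 * (2 * c * d))) * X
      + C (u - (2 * a * c + b * b + 2 * (d * d))) * X ^ 2
      + C (0 - (2 * a * d + 2 * b * c)) * X ^ 3 := by
    obtain ⟨w, hw⟩ := hx
    refine ⟨w + (2 * r * q + (X ^ 4 - C 2) * q * q) +
      (C (2 * b * d + c * c) + C (2 * c * d) * X + C (d * d) * X ^ 2), ?_⟩
    subst hp
    have e : (C t + C u * X ^ 2 : Polynomial (ZMod 4)) = r * r + ((X ^ 4 - C 2) *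
      (w + (2 * r * q + (X ^ 4 - C 2) * q * q))) := by linear_combination hw
    have e2 : r * r = (C a + C b * X + C c * X ^ 2 + C d * X ^ 3) ^ 2 := by rw [hr']; ring
    rw [e2] at e
    have h2 : (C 2 : Polynomial (ZMod 4)) = 2 := rfl
    simp only [map_add, map_mul, map_sub, map_zero, h2] at e ⊢
    linear_combination e
  have hz := (hm.not_dvd_of_degree_lt (q := _) · · key)
  have h0 := by_contra fun hne => hz hne (by
    rw [hdeg]
    refine lt_of_le_of_lt (b := (3 : WithBot ℕ)) ?_ (by norm_num)
    compute_degree)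
  have c0 := congrArg (coeff · 0) h0
  have c1 := congrArg (coeff · 1) h0
  have c2 := congrArg (coeff · 2) h0
  have c3 := congrArg (coeff · 3) h0
  simp only [coeff_add, coeff_C_mul, coeff_C, coeff_X, coeff_X_pow, coeff_zero] at c0 c1 c2 c3
  norm_num at c0 c1 c2 c3
  refine ⟨?_, ?_, ?_, ?_⟩
  · linear_combination c0
  · linear_combination c1
  · linear_combination c2
  · linear_combination c3

set_option maxRecDepth 100000 in
/-- In `(ℤ/4ℤ)[X]/(X⁴ - 2)`, none of `-1`, `2 + X²`, `-(2 + X²)` is a square. -/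
theorem stmt4 :
    ¬ IsSquare (-1 : R4) ∧
    ¬ IsSquare (Ideal.Quotient.mk (Ideal.span {(X : Polynomial (ZMod 4)) ^ 4 - C 2})
        (C 2 + X ^ 2)) ∧
    ¬ IsSquare (-(Ideal.Quotient.mk (Ideal.span {(X : Polynomial (ZMod 4)) ^ 4 - C 2})
        (C 2 + X ^ 2))) := by
  refine ⟨fun h => ?_, fun h => ?_, fun h => ?_⟩
  · exact absurd (sq_coeffs (-1) 0 (by simpa using h)) (by decide)
  · exact absurd (sq_coeffs 2 1 (by rw [map_one, one_mul]; exact h)) (by decide)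
  · have e : (C (-2) + C (-1) * X ^ 2 : Polynomial (ZMod 4)) = -(C 2 + X ^ 2) := by
      rw [C_neg, C_neg, C_1]; ring
    exact absurd (sq_coeffs (-2) (-1) (by rw [e, map_neg]; exact h)) (by decide)
end
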